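/- Let S⃗ be a finite submodular separation system inside a universe of separations, let P be a profile of S, and let Y ⊆ P be a nested set of oriented separations such that for every y ∈ Y the inverse y* is closely related to some profile Q_y of S. Let P_Y ⊆ P be the set of all oriented separations in P whose underlying separations are nested with (the underlying separations of) Y. Then every maximal element of P_Y is closely related to P. -/

import Mathlib

namespace SepSys

variable {U : Type*} [Lattice U]

/-- `inv` is an order-reversing involution on the universe `U`. -/
def IsInvol (inv : U → U) : Prop :=
  (∀ s, inv (inv s) = s) ∧ ∀ r s : U, r ≤ s → inv s ≤ inv r

/-- `Sv` is a separation system inside the universe `U`: a subset closed under the involution. -/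
def IsSepSys (inv : U → U) (Sv : Set U) : Prop :=
  ∀ s ∈ Sv, inv s ∈ Sv

/-- structural submodularity of a separation system inside a universe -/
def SubmodularSys (Sv : Set U) : Prop :=
  ∀ r ∈ Sv, ∀ s ∈ Sv, r ⊔ s ∈ Sv ∨ r ⊓ s ∈ Sv

/-- the (unoriented) separations underlying `r` and `s` are nested -/
def Nested (inv : U → U) (r s : U) : Prop :=
  r ≤ s ∨ r ≤ inv s ∨ inv r ≤ s ∨ inv r ≤ inv s

def NestedSet (inv : U → U) (N : Set U) : Prop :=
  ∀ r ∈ N, ∀ s ∈ N, Nested inv r s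

def NestedWithAll (inv : U → U) (M : Set U) (s : U) : Prop :=
  ∀ m ∈ M, Nested inv s m

/-- `N` represents a set of unoriented separations of `Sv`:
we represent such a set by the set of all orientations of its elements. -/
def UnorientedIn (inv : U → U) (Sv N : Set U) : Prop :=
  N ⊆ Sv ∧ ∀ s ∈ N, inv s ∈ N

/-- `O` is an orientation of (the set of unoriented separations of) `Sv` -/
def IsOrientation (inv : U → U) (Sv O : Set U) : Prop :=
  O ⊆ Sv ∧ (∀ s ∈ Sv, s ∈ O ∨ inv s ∈ O) ∧ ∀ s ∈ O, inv s ∈ O → inv s = s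

def Consistent (inv : U → U) (O : Set U) : Prop :=
  ∀ a ∈ O, ∀ b ∈ O, a ≠ b → ¬ inv a < b

def IsProfile (inv : U → U) (Sv P : Set U) : Prop :=
  IsOrientation inv Sv P ∧ Consistent inv P ∧ ∀ r ∈ P, ∀ s ∈ P, inv (r ⊔ s) ∉ P

def IsStarIn (inv : U → U) (Sv σ : Set U) : Prop :=
  σ ⊆ Sv ∧ (∀ s ∈ σ, inv s ≠ s) ∧ ∀ r ∈ σ, ∀ s ∈ σ, r ≠ s → r ≤ inv s

def IsFTangle (inv : U → U) (Sv : Set U) (F : Set (Set U)) (O : Set U) : Prop :=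
  IsOrientation inv Sv O ∧ Consistent inv O ∧ ∀ σ ∈ F, ¬ σ ⊆ O

/-- the non-degenerate separation underlying `s` distinguishes `O` and `O'` -/
def Distinguishes (inv : U → U) (s : U) (O O' : Set U) : Prop :=
  inv s ≠ s ∧ ((s ∈ O ∧ inv s ∈ O') ∨ (inv s ∈ O ∧ s ∈ O'))

def DistinguishesAll (inv : U → U) (N : Set U) (Ps : Set (Set U)) : Prop :=
  ∀ P ∈ Ps, ∀ P' ∈ Ps, P ≠ P' → ∃ s ∈ N, Distinguishes inv s P P'

def CloselyRelated (inv : U → U) (Sv O : Set U) (s : U) : Prop :=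
  s ∈ O ∧ ∀ r ∈ O, s ⊓ r ∈ Sv

def DistinguishesWell (inv : U → U) (Sv P P' : Set U) (s : U) : Prop :=
  (CloselyRelated inv Sv P s ∧ CloselyRelated inv Sv P' (inv s)) ∨
    (CloselyRelated inv Sv P' s ∧ CloselyRelated inv Sv P (inv s))

def GoodFor (inv : U → U) (Sv : Set U) (Ps : Set (Set U)) (s : U) : Prop :=
  ∃ P ∈ Ps, ∃ P' ∈ Ps, P ≠ P' ∧ DistinguishesWell inv Sv P P' s

def MaxElems (O : Set U) : Set U :=
  {x ∈ O | ∀ y ∈ O, x ≤ y → x = y}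

/-- `σ` is a node of the nested set `N` (represented with all orientations of its elements) -/
def IsNode (inv : U → U) (N σ : Set U) : Prop :=
  IsStarIn inv N σ ∧ ∃ O, IsOrientation inv N O ∧ Consistent inv O ∧ σ = MaxElems O

def IsTrivialIn (inv : U → U) (Sv : Set U) (s : U) : Prop :=
  ∃ r ∈ Sv, ({r, inv r} : Set U) ≠ {s, inv s} ∧ s < r ∧ s < inv r

def SmallSep (inv : U → U) (s : U) : Prop := s ≤ inv s

def StandardSet (inv : U → U) (Sv : Set U) (F : Set (Set U)) : Prop :=
  ∀ s ∈ Sv, IsTrivialIn inv Sv s → ({inv s} : Set U) ∈ F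

def Emulates (inv : U → U) (Sv : Set U) (r s : U) : Prop :=
  r ≤ s ∧ ∀ x ∈ Sv, r ≤ x → x ≠ inv r → s ⊔ x ∈ Sv

open Classical in
/-- the shifting map `f↓` -/
noncomputable def shiftMap (inv : U → U) (r s x : U) : U :=
  if r ≤ x then x ⊔ s else inv (inv x ⊔ s)

def ClosedUnderShifting (inv : U → U) (Sv : Set U) (F : Set (Set U)) : Prop :=
  ∀ r ∈ Sv, ∀ s ∈ Sv, inv r ≠ r → ¬ IsTrivialIn inv Sv r → Emulates inv Sv r s →
    ∀ σ ∈ F, (∀ x ∈ σ, x ∈ Sv ∧ (r ≤ x ∨ r ≤ inv x) ∧ x ≠ inv r) →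
      (∃ t ∈ σ, r ≤ t) → shiftMap inv r s '' σ ∈ F

def Friendly (inv : U → U) (Sv : Set U) (F : Set (Set U)) : Prop :=
  (∀ σ ∈ F, IsStarIn inv Sv σ) ∧ StandardSet inv Sv F ∧
    ClosedUnderShifting inv Sv F ∧
    (∀ s ∈ Sv, SmallSep inv s → ({inv s} : Set U) ∈ F) ∧
    ∀ O, IsFTangle inv Sv F O → IsProfile inv Sv O

def IsAut (inv : U → U) (Sv : Set U) (φ : U → U) : Prop :=
  Set.BijOn φ Sv Sv ∧ (∀ r ∈ Sv, ∀ s ∈ Sv, (r ≤ s ↔ φ r ≤ φ s)) ∧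
    ∀ s ∈ Sv, φ (inv s) = inv (φ s)

/-- the separations of `Sv` that are nested with all separations in `M` -/
def SvM (inv : U → U) (Sv M : Set U) : Set U :=
  {s ∈ Sv | NestedWithAll inv M s}

/-- the set `E_P` of `P`-exclusive separations in `P_M` distinguishing `P` well
from some other profile in `Ps` -/
def EP (inv : U → U) (Sv M : Set U) (Ps : Set (Set U)) (P : Set U) : Set U :=
  {s ∈ P ∩ SvM inv Sv M | (∀ P' ∈ Ps, s ∈ P' → P' = P) ∧
    ∃ P' ∈ Ps, P' ≠ P ∧ DistinguishesWell inv Sv P P' s}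

/-- the set `M_{P,i}` from the construction of the canonical nested set:
separations nested with the previously chosen set `N` that are `P`-exclusive
for the remaining profiles `Q` and maximal in `P ∩ S⃗_i` -/
def MpOf (inv : U → U) (Sv N : Set U) (Q : Set (Set U)) (P : Set U) : Set U :=
  {s ∈ SvM inv Sv N | s ∈ P ∧ (∀ P' ∈ Q, s ∈ P' → P' = P) ∧
    ∀ x ∈ P ∩ SvM inv Sv N, s ≤ x → s = x}

def QiOf (inv : U → U) (Sv N : Set U) (Q : Set (Set U)) : Set (Set U) :=
  {P ∈ Q | (MpOf inv Sv N Q P).Nonempty}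

/-- step `i` of the construction: the pair `(N_i, Ps_{≥ i+1})` -/
def constrStep (inv : U → U) (Sv : Set U) (Ps : Set (Set U)) : ℕ → Set U × Set (Set U)
  | 0 => (∅, Ps)
  | (i+1) =>
      let p := constrStep inv Sv Ps i
      (p.1 ∪ {x | ∃ P ∈ QiOf inv Sv p.1 p.2, ∃ y,
          IsGLB (MpOf inv Sv p.1 p.2 P) y ∧ (x = y ∨ x = inv y)},
        p.2 \ QiOf inv Sv p.1 p.2)

/-- the least `K` such that `Ps_{≥ K+1}` contains at most one profile -/
noncomputable def stopIndex (inv : U → U) (Sv : Set U) (Ps : Set (Set U)) : ℕ :=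
  sInf {i | ((constrStep inv Sv Ps i).2).Subsingleton}

/-- the canonical nested set `N(S⃗, Ps)` -/
noncomputable def canonicalN (inv : U → U) (Sv : Set U) (Ps : Set (Set U)) : Set U :=
  (constrStep inv Sv Ps (stopIndex inv Sv Ps)).1

end SepSys

open SepSys

namespace SepSys

variable {U : Type*} [Lattice U] {inv : U → U} {Sv P : Set U}

theorem IsInvol.inv_inf (hinv : IsInvol inv) (a b : U) : inv (inv a ⊓ inv b) = a ⊔ b := by
  apply le_antisymm
  · have h : inv (a ⊔ b) ≤ inv a ⊓ inv b :=
      le_inf (hinv.2 _ _ le_sup_left) (hinv.2 _ _ le_sup_right)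
    simpa only [hinv.1] using hinv.2 _ _ h
  · apply sup_le
    · simpa only [hinv.1] using hinv.2 _ _ (inf_le_left : inv a ⊓ inv b ≤ inv a)
    · simpa only [hinv.1] using hinv.2 _ _ (inf_le_right : inv a ⊓ inv b ≤ inv b)

theorem IsInvol.le_inv_comm (hinv : IsInvol inv) {a b : U} (h : a ≤ inv b) : b ≤ inv a := by
  simpa only [hinv.1] using hinv.2 _ _ h

/-- A profile contains no separation together with its inverse; in particular it contains no
degenerate separation. -/
theorem IsProfile.inv_notMem (hP : IsProfile inv Sv P) {a : U} (ha : a ∈ P) : inv a ∉ P := by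
  simpa using hP.2.2 a ha a ha

theorem IsProfile.sup_mem (hP : IsProfile inv Sv P) {a b : U} (ha : a ∈ P) (hb : b ∈ P)
    (hab : a ⊔ b ∈ Sv) : a ⊔ b ∈ P :=
  (hP.1.2.1 _ hab).resolve_right (hP.2.2 a ha b hb)

/-- A profile is down-closed, up to the possible exception of inverses of its own elements. -/
theorem IsProfile.mem_of_le (hP : IsProfile inv Sv P) (hinv : IsInvol inv) {a b : U} (ha : a ∈ Sv)
    (hb : b ∈ P) (hab : a ≤ b) (hne : inv a ≠ b) : a ∈ P := by
  rcases hP.1.2.1 a ha with h | h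
  · exact h
  · rcases hab.eq_or_lt with rfl | hlt
    · exact hb
    · refine absurd ?_ (hP.2.1 _ h b hb hne)
      rwa [hinv.1]

theorem IsProfile.inf_mem (hP : IsProfile inv Sv P) (hinv : IsInvol inv) {a b : U} (ha : a ∈ P)
    (hb : b ∈ P) (hab : a ⊓ b ∈ Sv) : a ⊓ b ∈ P := by
  by_cases h : inv (a ⊓ b) = a
  · by_cases h' : inv (a ⊓ b) = b
    · have : a = b := h.symm.trans h'
      subst this
      simpa using ha
    · exact hP.mem_of_le hinv hab hb inf_le_right h'
  · exact hP.mem_of_le hinv hab ha inf_le_left h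

theorem IsProfile.le_or_le_or_le_inv (hP : IsProfile inv Sv P) {a b : U}
    (ha : a ∈ P) (hb : b ∈ P) (hab : Nested inv a b) (hinv : IsInvol inv) :
    a ≤ b ∨ b ≤ a ∨ a ≤ inv b := by
  rcases hab with h | h | h | h
  · exact .inl h
  · exact .inr (.inr h)
  · by_cases hne : a = b
    · exact .inl hne.le
    · rcases h.eq_or_lt with h' | h'
      · exact absurd (h' ▸ hb) (hP.inv_notMem ha)
      · exact absurd h' (hP.2.1 a ha b hb hne)
  · exact .inr (.inl (by simpa only [hinv.1] using hinv.2 _ _ h))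

/-- If `inv y` is closely related to some profile and `r ∈ P`, then either `r ⊓ inv y ∈ P`, or every
element of `P` above `r` has its join with `y` in `P`. -/
theorem IsProfile.inf_inv_mem_or_sup_mem (hP : IsProfile inv Sv P) (hinv : IsInvol inv)
    (hsys : IsSepSys inv Sv) {Q : Set U} (hQ : IsProfile inv Sv Q) {y r : U} (hy : y ∈ P)
    (hyQ : CloselyRelated inv Sv Q (inv y)) (hr : r ∈ P) :
    r ⊓ inv y ∈ P ∨ ∀ t ∈ P, r ≤ t → t ⊔ y ∈ P := by
  have hyQ' : y ∉ Q := fun h => hQ.inv_notMem h hyQ.1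
  rcases hQ.1.2.1 r (hP.1.1 hr) with hrQ | hrQ
  · left
    have hmem : r ⊓ inv y ∈ Sv := inf_comm r (inv y) ▸ hyQ.2 r hrQ
    refine hP.mem_of_le hinv hmem hr inf_le_left fun h => ?_
    have hyr : y ≤ r := by
      rw [← h]
      exact hinv.le_inv_comm inf_le_right
    refine hyQ' (hQ.mem_of_le hinv (hP.1.1 hy) hrQ hyr fun h' => ?_)
    exact hP.inv_notMem hy (h' ▸ hr)
  · right
    intro t ht hrt
    have htQ : inv t ∈ Q := by
      refine (hQ.1.2.1 t (hP.1.1 ht)).resolve_left fun h => ?_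
      refine hQ.inv_notMem (hQ.mem_of_le hinv (hP.1.1 hr) h hrt fun h' => ?_) hrQ
      exact hP.inv_notMem hr (h' ▸ ht)
    have h := hsys _ (hyQ.2 _ htQ)
    rw [hinv.inv_inf, sup_comm] at h
    exact hP.sup_mem ht hy h

/-- If joining elements of a finite set `B` to elements of `P` above `t₀` stays inside `P`, then the
join of `t₀` with all of `B` lies in `P`. -/
theorem exists_isLUB_insert_mem {B : Set U} (hB : B.Finite) {t₀ : U} (ht₀ : t₀ ∈ P)
    (hjoin : ∀ b ∈ B, ∀ t ∈ P, t₀ ≤ t → t ⊔ b ∈ P) : ∃ t ∈ P, IsLUB (insert t₀ B) t := by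
  induction B, hB using Set.Finite.induction_on with
  | empty => exact ⟨t₀, ht₀, by simp⟩
  | @insert b B _ _ ih =>
    obtain ⟨t, ht, hlub⟩ := ih fun b' hb' => hjoin b' (Set.mem_insert_of_mem _ hb')
    refine ⟨t ⊔ b, hjoin b (Set.mem_insert _ _) t ht (hlub.1 (Set.mem_insert _ _)), ?_⟩
    rw [Set.insert_comm, sup_comm]
    exact hlub.insert b

end SepSys

theorem maximal_nested_with_Y_closely_related {U : Type*} [Lattice U] (inv : U → U) (Sv : Set U)
    (hinv : IsInvol inv) (hfin : Sv.Finite) (hsys : IsSepSys inv Sv)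
    (hsub : SubmodularSys Sv)
    (P : Set U) (hP : IsProfile inv Sv P)
    (Y : Set U) (hYP : Y ⊆ P) (hYnested : NestedSet inv Y)
    (hYrel : ∀ y ∈ Y, ∃ Q : Set U, IsProfile inv Sv Q ∧ CloselyRelated inv Sv Q (inv y)) :
    ∀ s ∈ P, NestedWithAll inv Y s →
      (∀ x ∈ P, NestedWithAll inv Y x → s ≤ x → s = x) →
      CloselyRelated inv Sv P s := by
  intro s hs hsY hmax
  refine ⟨hs, ?_⟩
  by_contra! hbad
  have hYfin : Y.Finite := hfin.subset (hYP.trans hP.1.1)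
  have hRfin : {r ∈ P | s ⊓ r ∉ Sv}.Finite := hfin.subset fun r h => hP.1.1 h.1
  obtain ⟨r, ⟨hr, hsr⟩, hrmin⟩ := hRfin.exists_minimal hbad
  have hsrP : s ⊔ r ∈ P :=
    hP.sup_mem hs hr ((hsub s (hP.1.1 hs) r (hP.1.1 hr)).resolve_right hsr)
  have hYY : ∀ y ∈ Y, ∀ z ∈ Y, y ≤ z ∨ z ≤ y ∨ y ≤ inv z := fun y hy z hz =>
    hP.le_or_le_or_le_inv (hYP hy) (hYP hz) (hYnested y hy z hz) hinv
  have above : ∀ y ∈ Y, s ≤ y → r ≤ y ∨ r ⊔ y ∈ P := by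
    intro y hy hsy
    rcases hsub r (hP.1.1 hr) y (hP.1.1 (hYP hy)) with h | h
    · exact .inr (hP.sup_mem hr (hYP hy) h)
    · left
      have hmem : r ⊓ y ∈ {r ∈ P | s ⊓ r ∉ Sv} := by
        refine ⟨hP.inf_mem hinv hr (hYP hy) h, ?_⟩
        rwa [inf_comm r y, ← inf_assoc, inf_eq_left.2 hsy]
      exact (hrmin hmem inf_le_left).trans inf_le_right
  have below : ∀ y ∈ Y, s ≤ inv y → r ≤ inv y ∨ ∀ t ∈ P, r ≤ t → t ⊔ y ∈ P := by
    intro y hy hsy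
    obtain ⟨Q, hQ, hyQ⟩ := hYrel y hy
    refine (hP.inf_inv_mem_or_sup_mem hinv hsys hQ (hYP hy) hyQ hr).imp_left fun h => ?_
    have hmem : r ⊓ inv y ∈ {r ∈ P | s ⊓ r ∉ Sv} := by
      refine ⟨h, ?_⟩
      rwa [inf_comm r, ← inf_assoc, inf_eq_left.2 hsy]
    exact (hrmin hmem inf_le_left).trans inf_le_right
  let B : Set U := {y ∈ Y | s ≤ inv y ∧ ¬ r ≤ inv y ∧ ¬ s ⊔ r ≤ y}
  let A : Set U := {y ∈ Y | s ≤ y ∧ ¬ s ≤ inv y ∧ ¬ r ≤ y}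
  have position : ∀ y ∈ Y, y ∈ B ∨ y ≤ s ∨ y ∈ A ∨ s ⊔ r ≤ y ∨ s ⊔ r ≤ inv y := by
    intro y hy
    rcases hP.le_or_le_or_le_inv hs (hYP hy) (hsY y hy) hinv with h | h | h <;>
    simp only [A, B, Set.mem_ofPred_eq, sup_le_iff] <;> tauto
  obtain ⟨t₀, ht₀, hsrt, hnest⟩ : ∃ t₀ ∈ P, s ⊔ r ≤ t₀ ∧
      ∀ y ∈ Y, y ∈ B ∨ y ≤ t₀ ∨ t₀ ≤ y ∨ t₀ ≤ inv y := by
    rcases A.eq_empty_or_nonempty with hA | hA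
    · refine ⟨s ⊔ r, hsrP, le_rfl, fun y hy => ?_⟩
      rcases position y hy with h | h | h | h
      · exact .inl h
      · exact .inr (.inl (h.trans le_sup_left))
      · simp [hA] at h
      · exact .inr (.inr h)
    · obtain ⟨m, ⟨hmY, hsm, hsm', hrm⟩, hmmax⟩ :=
        (hYfin.subset (Set.sep_subset _ _ : A ⊆ Y)).exists_maximal hA
      refine ⟨r ⊔ m, (above m hmY hsm).resolve_left hrm,
        sup_le (hsm.trans le_sup_right) le_sup_left, fun y hy => ?_⟩
      rcases position y hy with h | h | h | h | h
      · exact .inl h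
      · exact .inr (.inl (h.trans (hsm.trans le_sup_right)))
      · refine .inr (.inl (le_trans ?_ le_sup_right))
        rcases hYY y hy m hmY with h' | h' | h'
        · exact h'
        · exact hmmax h h'
        · exact absurd (h.2.1.trans h') hsm'
      · rcases hYY y hy m hmY with h' | h' | h'
        · exact .inr (.inl (h'.trans le_sup_right))
        · exact .inr (.inr (.inl (sup_le (le_sup_right.trans h) h')))
        · exact absurd ((le_sup_left.trans h).trans h') hsm'
      · rcases hYY y hy m hmY with h' | h' | h'
        · exact .inr (.inl (h'.trans le_sup_right))
        · exact absurd ((le_sup_left.trans h).trans (hinv.2 _ _ h')) hsm'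
        · exact .inr (.inr (.inr (sup_le (le_sup_right.trans h) (hinv.le_inv_comm h'))))
  obtain ⟨t, ht, hlub⟩ := exists_isLUB_insert_mem (hYfin.subset (Set.sep_subset _ _ : B ⊆ Y)) ht₀
    fun b hb t ht h => ((below b hb.1 hb.2.1).resolve_left hb.2.2.1) t ht
      (le_sup_right.trans (hsrt.trans h))
  have ht₀t : t₀ ≤ t := hlub.1 (Set.mem_insert _ _)
  have hBt : ∀ b ∈ B, b ≤ t := fun b hb => hlub.1 (Set.mem_insert_of_mem _ hb)
  have hle : ∀ u, t₀ ≤ u → (∀ b ∈ B, b ≤ u) → t ≤ u := fun u h₀ h =>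
    hlub.2 (Set.forall_mem_insert.2 ⟨h₀, h⟩)
  have htY : NestedWithAll inv Y t := by
    intro y hy
    by_cases hyt : y ≤ t
    · exact .inr (.inr (.inr (hinv.2 _ _ hyt)))
    rcases hnest y hy with h | h | h | h
    · exact absurd (hBt y h) hyt
    · exact absurd (h.trans ht₀t) hyt
    · refine .inl (hle y h fun b hb => ?_)
      rcases hYY b hb.1 y hy with h' | h' | h'
      · exact h'
      · exact absurd (h'.trans (hBt b hb)) hyt
      · exact absurd ((le_sup_right.trans (hsrt.trans h)).trans (hinv.le_inv_comm h')) hb.2.2.1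
    · refine .inr (.inl (hle _ h fun b hb => ?_))
      rcases hYY b hb.1 y hy with h' | h' | h'
      · exact absurd ((le_sup_right.trans (hsrt.trans h)).trans (hinv.2 _ _ h')) hb.2.2.1
      · exact absurd (h'.trans (hBt b hb)) hyt
      · exact h'
  have hst : s = t := hmax t ht htY (le_sup_left.trans (hsrt.trans ht₀t))
  have hrs : r ≤ s := by
    rw [hst]
    exact le_sup_right.trans (hsrt.trans ht₀t)
  exact hsr (by rw [inf_eq_right.2 hrs]; exact hP.1.1 hr)
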